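/- arXiv:0709.2493 — 2 statements merged into one kernel-verified Lean document; each statement's English description precedes it below -/
import Mathlib

section
/- Let θ ∈ (0,1), α > 0 and 0 < ν < 1. There exists a constant C = C(ν, θ, α) such that for every σ ∈ (0,1), every t ≥ 1, and all vectors v, u ∈ ℝ³ with |v| ≤ ν and |u| ≤ ν, one has |γ_σ(v, u, t)| ≤ C; that is, the infrared phase is bounded uniformly in the infrared cutoff σ and in time t. -/
open MeasureTheory
open scoped RealInnerProductSpace

noncomputable section

/-- ℝ³ as a Euclidean space. -/
abbrev E3 := EuclideanSpace ℝ (Fin 3)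

/-- The closed annulus `{k : a ≤ |k| ≤ b}` in ℝ³. -/
def annulus (a b : ℝ) : Set E3 := {k | a ≤ ‖k‖ ∧ ‖k‖ ≤ b}

/-- The soft-photon velocity field
`Σ_v(k) = (2 / (|k|² (1 − (k/|k|)·v))) • (v − ((k·v)/|k|²) k)`. -/
def Sig (v k : E3) : E3 :=
  (2 / (‖k‖ ^ 2 * (1 - ⟪k, v⟫ / ‖k‖))) • (v - (⟪k, v⟫ / ‖k‖ ^ 2) • k)

/-- The infrared phase
`γ_σ(v,u,t) = −α ∫₁^{min(t, σ^{−1/θ})} u · ( ∫_{A(σ, τ^{−θ})} Σ_v(k) cos(k·u τ − |k| τ) dk ) dτ`.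
(The inner integral is automatically `0` when `τ^{−θ} < σ`, since then the annulus is empty.) -/
def gammaIR (α θ : ℝ) (v u : E3) (σ t : ℝ) : ℝ :=
  -α * ∫ τ in (1:ℝ)..(min t (σ ^ (-(1/θ)))),
    ⟪u, ∫ k in annulus σ (τ ^ (-θ)),
        Real.cos (⟪k, u⟫ * τ - ‖k‖ * τ) • Sig v k⟫


lemma polarE3 (f : E3 → ℝ) (hf : Integrable f) :
    ∫ k, f k = ∫ ω : Metric.sphere (0 : E3) 1,
      (∫ r in Set.Ioi (0 : ℝ), r ^ 2 * f (r • (ω : E3))) ∂((volume : Measure E3).toSphere) := by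
  have hdim : Module.finrank ℝ E3 - 1 = 2 := by simp
  have hmp := (volume : Measure E3).measurePreserving_homeomorphUnitSphereProd
  rw [hdim] at hmp
  have hemb := (homeomorphUnitSphereProd E3).measurableEmbedding
  let g : Metric.sphere (0 : E3) 1 × Set.Ioi (0 : ℝ) → ℝ :=
    fun p => f ((p.2 : ℝ) • (p.1 : E3))
  have hg : g ∘ (homeomorphUnitSphereProd E3) = f ∘ ((↑) : ({0}ᶜ : Set E3) → E3) := by
    funext x
    have h := congrArg Subtype.val ((homeomorphUnitSphereProd E3).symm_apply_apply x)
    rw [homeomorphUnitSphereProd_symm_apply_coe] at h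
    simp only [Function.comp, g, h]
  have hgi : Integrable g
      ((volume : Measure E3).toSphere.prod (Measure.volumeIoiPow 2)) := by
    rw [← hmp.integrable_comp_emb hemb, hg,
      ← integrableOn_iff_comap_subtypeVal (measurableSet_singleton _).compl]
    exact hf.integrableOn
  calc ∫ k, f k = ∫ x : ({(0)}ᶜ : Set E3), f x.1 ∂((volume : Measure E3).comap (↑)) := by
        rw [integral_subtype_comap (measurableSet_singleton _).compl f,
          restrict_compl_singleton]
    _ = ∫ p, g p ∂((volume : Measure E3).toSphere.prod (Measure.volumeIoiPow 2)) := by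
        rw [← hmp.integral_comp hemb]
        exact integral_congr_ae (.of_forall fun x => (congrFun hg x).symm)
    _ = _ := by
        rw [integral_prod _ hgi]
        congr 1
        funext ω
        simp only [Measure.volumeIoiPow, ENNReal.ofReal, g]
        rw [integral_withDensity_eq_integral_smul,
          integral_subtype_comap measurableSet_Ioi
            fun a ↦ Real.toNNReal (a ^ 2) • f (a • (ω : E3)),
          setIntegral_congr_fun measurableSet_Ioi fun x hx ↦ ?_]
        · rw [NNReal.smul_def, Real.coe_toNNReal _ (pow_nonneg hx.out.le _), smul_eq_mul]
        · exact (measurable_subtype_coe.pow_const _).real_toNNReal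

lemma sinc_int (a b : ℝ) (ha : 0 < a) (hab : a ≤ b) (f : ℝ → ℝ)
    (hf : f = fun s => Real.sin s / s) : IntervalIntegrable f volume a b := by
  subst hf
  apply ContinuousOn.intervalIntegrable
  rw [Set.uIcc_of_le hab]
  exact Real.continuous_sin.continuousOn.div continuousOn_id
    (fun x hx => (lt_of_lt_of_le ha hx.1).ne')

lemma sinc_small (a b : ℝ) (ha : 0 < a) (hab : a ≤ b) (hb : b ≤ 1) :
    |∫ s in a..b, Real.sin s / s| ≤ 1 := by
  have := intervalIntegral.norm_integral_le_of_norm_le_const (a := a) (b := b) (C := 1)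
    (f := fun s => Real.sin s / s) (by
      intro x hx
      rw [Set.uIoc_of_le hab] at hx
      have hx0 : 0 < x := ha.trans hx.1
      rw [Real.norm_eq_abs, abs_div, div_le_one (by positivity)]
      exact Real.abs_sin_le_abs)
  rw [Real.norm_eq_abs, abs_of_nonneg (sub_nonneg.2 hab)] at this
  linarith

lemma sinc_large (a b : ℝ) (ha : 1 ≤ a) (hab : a ≤ b) :
    |∫ s in a..b, Real.sin s / s| ≤ 3 := by
  have hpos : ∀ x ∈ Set.uIcc a b, 0 < x := by
    intro x hx
    rw [Set.uIcc_of_le hab] at hx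
    linarith [hx.1]
  have hc2 : IntervalIntegrable (fun s => Real.cos s / s ^ 2) volume a b := by
    apply ContinuousOn.intervalIntegrable
    exact Real.continuous_cos.continuousOn.div (continuousOn_id.pow 2)
      (fun x hx => (pow_pos (hpos x hx) 2).ne')
  have hc3 : IntervalIntegrable (fun s : ℝ => 1 / s ^ 2) volume a b := by
    apply ContinuousOn.intervalIntegrable
    exact continuousOn_const.div (continuousOn_id.pow 2)
      (fun x hx => (pow_pos (hpos x hx) 2).ne')
  have hs := sinc_int a b (by linarith) hab _ rfl
  have h1 : ∫ s in a..b, (Real.sin s / s + Real.cos s / s ^ 2)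
      = (-Real.cos b / b) - (-Real.cos a / a) := by
    apply intervalIntegral.integral_eq_sub_of_hasDerivAt (f := fun s => -Real.cos s / s)
    · intro x hx
      have hx0 := (hpos x hx).ne'
      refine (((Real.hasDerivAt_cos x).fun_neg).fun_div (hasDerivAt_id' x) hx0).congr_deriv ?_
      field_simp
      ring
    · exact hs.add hc2
  have h2 : ∫ s in a..b, 1 / s ^ 2 = (-1 / b) - (-1 / a) := by
    apply intervalIntegral.integral_eq_sub_of_hasDerivAt (f := fun s => -1 / s)
    · intro x hx
      have hx0 := (hpos x hx).ne'
      refine ((hasDerivAt_const x (-1 : ℝ)).fun_div (hasDerivAt_id' x) hx0).congr_deriv ?_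
      simp
    · exact hc3
  have h3 : |∫ s in a..b, Real.cos s / s ^ 2| ≤ ∫ s in a..b, 1 / s ^ 2 := by
    rw [← Real.norm_eq_abs]
    apply intervalIntegral.norm_integral_le_of_norm_le hab _ hc3
    refine .of_forall fun x hx => ?_
    rw [Real.norm_eq_abs, abs_div, abs_of_nonneg (sq_nonneg x)]
    gcongr
    exact Real.abs_cos_le_one x
  rw [intervalIntegral.integral_add hs hc2] at h1
  have hb : 1 ≤ b := ha.trans hab
  have h4 : ∀ x : ℝ, 1 ≤ x → |Real.cos x / x| ≤ 1 / x := by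
    intro x hx
    rw [abs_div, abs_of_pos (by linarith : 0 < x)]
    have := Real.abs_cos_le_one x
    gcongr
  have ha4 := abs_le.1 (h4 a ha)
  have hb4 := abs_le.1 (h4 b hb)
  have h5 : 1 / a ≤ 1 := (div_le_one (by linarith)).2 ha
  have h6 : 0 < 1 / b := by positivity
  have h7 : 1 / b ≤ 1 := (div_le_one (by linarith)).2 hb
  rw [h2] at h3
  have h3' := abs_le.1 h3
  simp only [neg_div] at h1 h3'
  rw [abs_le]
  constructor <;> linarith

lemma sinc_bound (a b : ℝ) (ha : 0 < a) (hab : a ≤ b) :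
    |∫ s in a..b, Real.sin s / s| ≤ 4 := by
  rcases le_total b 1 with hb | hb
  · linarith [sinc_small a b ha hab hb]
  rcases le_total 1 a with h | h
  · linarith [sinc_large a b h hab]
  rw [← intervalIntegral.integral_add_adjacent_intervals
    (sinc_int a 1 ha h _ rfl) (sinc_int 1 b one_pos hb _ rfl)]
  refine (abs_add_le _ _).trans ?_
  linarith [sinc_small a 1 ha h le_rfl, sinc_large 1 b le_rfl hb]

lemma osc_bound (l p T : ℝ) (hl : 0 < l) (hp : 0 < p) (hT : 1 ≤ T) :
    |∫ τ in (1:ℝ)..T, Real.sin (l * τ ^ p) / τ| ≤ 4 / p := by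
  have hpos : ∀ x ∈ Set.uIcc 1 T, 0 < x := by
    intro x hx
    rw [Set.uIcc_of_le hT] at hx
    linarith [hx.1]
  have h := intervalIntegral.integral_comp_mul_deriv' (a := 1) (b := T)
    (f := fun τ => l * τ ^ p) (f' := fun τ => l * (p * τ ^ (p - 1)))
    (g := fun s => Real.sin s / s)
    (fun x hx => (Real.hasDerivAt_rpow_const (Or.inl (hpos x hx).ne')).const_mul l)
    (by
      refine continuousOn_const.mul (continuousOn_const.mul ?_)
      exact continuousOn_id.rpow_const fun x hx => Or.inl (hpos x hx).ne')
    (by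
      refine Real.continuous_sin.continuousOn.div continuousOn_id ?_
      rintro _ ⟨x, hx, rfl⟩
      exact (mul_pos hl (Real.rpow_pos_of_pos (hpos x hx) p)).ne')
  have h2 : ∫ τ in (1:ℝ)..T, ((fun s => Real.sin s / s) ∘ fun τ => l * τ ^ p) τ *
      (l * (p * τ ^ (p - 1))) = p * ∫ τ in (1:ℝ)..T, Real.sin (l * τ ^ p) / τ := by
    rw [← intervalIntegral.integral_const_mul]
    apply intervalIntegral.integral_congr
    intro x hx
    have hx0 := hpos x hx
    have := Real.rpow_pos_of_pos hx0 p
    simp only [Function.comp, Real.rpow_sub_one hx0.ne']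
    field_simp
  rw [h2] at h
  have hb := sinc_bound (l * 1 ^ p) (l * T ^ p) (by simpa using hl) (by gcongr)
  rw [← h, abs_mul, abs_of_pos hp] at hb
  rw [le_div_iff₀ hp]
  linarith

/-- The angular part of `u · Σ_v`. -/
def Gang (v u ω : E3) : ℝ := 2 / (1 - ⟪ω, v⟫) * (⟪u, v⟫ - ⟪ω, v⟫ * ⟪u, ω⟫)

lemma inner_unit_le (ν : ℝ) (v ω : E3) (hv : ‖v‖ ≤ ν) (hω : ‖ω‖ = 1) : |⟪ω, v⟫| ≤ ν := by
  have := abs_real_inner_le_norm ω v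
  rw [hω, one_mul] at this
  exact this.trans hv

lemma Gang_bound (ν : ℝ) (hν1 : ν < 1) (v u ω : E3) (hv : ‖v‖ ≤ ν) (hu : ‖u‖ ≤ ν)
    (hω : ‖ω‖ = 1) : |Gang v u ω| ≤ 4 / (1 - ν) := by
  have h1 := inner_unit_le ν v ω hv hω
  have h2 := inner_unit_le ν u ω hu hω
  rw [real_inner_comm] at h2
  have h3 : |⟪u, v⟫| ≤ 1 := by
    refine (abs_real_inner_le_norm u v).trans ?_
    exact mul_le_one₀ (by linarith) (norm_nonneg _) (by linarith)
  have h4 : |⟪ω, v⟫ * ⟪u, ω⟫| ≤ 1 := by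
    rw [abs_mul]
    exact mul_le_one₀ (by linarith) (abs_nonneg _) (by linarith)
  have h5 : 0 < 1 - ν := by linarith
  have h6 : 1 - ν ≤ 1 - ⟪ω, v⟫ := by linarith [(abs_le.1 h1).2]
  have h7 : |⟪u, v⟫ - ⟪ω, v⟫ * ⟪u, ω⟫| ≤ 2 := (abs_sub _ _).trans (by linarith)
  have h8 : |2 / (1 - ⟪ω, v⟫)| ≤ 2 / (1 - ν) := by
    rw [abs_of_pos (div_pos two_pos (h5.trans_le h6))]
    gcongr
  rw [Gang, abs_mul]
  calc _ ≤ 2 / (1 - ν) * 2 := by gcongr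
    _ = _ := by ring

lemma annulus_compact (a b : ℝ) : IsCompact (annulus a b) := by
  refine (isCompact_closedBall (0 : E3) b).of_isClosed_subset ?_ ?_
  · exact (isClosed_le continuous_const continuous_norm).inter
      (isClosed_le continuous_norm continuous_const)
  · intro k hk
    simpa using hk.2

lemma Sig_int (ν : ℝ) (hν1 : ν < 1) (v u : E3) (hv : ‖v‖ ≤ ν) (σ b τ : ℝ) (hσ : 0 < σ) :
    IntegrableOn (fun k : E3 => Real.cos (⟪k, u⟫ * τ - ‖k‖ * τ) • Sig v k) (annulus σ b) := by
  refine ContinuousOn.integrableOn_compact (annulus_compact σ b) ?_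
  have hk0 : ∀ k ∈ annulus σ b, ‖k‖ ≠ 0 := fun k hk => (hσ.trans_le hk.1).ne'
  have hk1 : ∀ k ∈ annulus σ b, 1 - ⟪k, v⟫ / ‖k‖ ≠ 0 := by
    intro k hk
    have hk' : 0 < ‖k‖ := hσ.trans_le hk.1
    have h1 := real_inner_le_norm k v
    have h2 : ⟪k, v⟫ / ‖k‖ ≤ ν := by
      rw [div_le_iff₀ hk']
      nlinarith
    intro h
    linarith
  have hi : Continuous fun k : E3 => ⟪k, v⟫ := by fun_prop
  have hco : Continuous fun k : E3 => Real.cos (⟪k, u⟫ * τ - ‖k‖ * τ) := by fun_prop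
  have hA : ContinuousOn (fun k : E3 => 2 / (‖k‖ ^ 2 * (1 - ⟪k, v⟫ / ‖k‖))) (annulus σ b) := by
    refine continuousOn_const.div ?_ ?_
    · refine (continuous_norm.pow 2).continuousOn.mul (continuousOn_const.sub ?_)
      exact hi.continuousOn.div continuous_norm.continuousOn hk0
    · intro k hk
      exact mul_ne_zero (pow_ne_zero _ (hk0 k hk)) (hk1 k hk)
  have hB0 : ContinuousOn (fun k : E3 => ⟪k, v⟫ / ‖k‖ ^ 2) (annulus σ b) :=
    hi.continuousOn.div (continuous_norm.pow 2).continuousOn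
      (fun k hk => pow_ne_zero _ (hk0 k hk))
  have hB : ContinuousOn (fun k : E3 => v - (⟪k, v⟫ / ‖k‖ ^ 2) • k) (annulus σ b) :=
    continuousOn_const.sub (hB0.smul continuousOn_id)
  exact hco.continuousOn.smul (hA.smul hB)

lemma Sig_polar (v u ω : E3) (r : ℝ) (hr : 0 < r) (hω : ‖ω‖ = 1) :
    r ^ 2 * ⟪u, Sig v (r • ω)⟫ = Gang v u ω := by
  have hn : ‖r • ω‖ = r := by rw [norm_smul, hω, Real.norm_eq_abs, abs_of_pos hr, mul_one]
  unfold Sig Gang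
  rw [hn]
  simp only [inner_smul_left, inner_smul_right, inner_sub_right, smul_smul]
  simp only [conj_trivial]
  have h1 : r * ⟪ω, v⟫ / r = ⟪ω, v⟫ := by field_simp
  rw [h1]
  by_cases h : 1 - ⟪ω, v⟫ = 0
  · simp [h]
  · field_simp

lemma radial (c g σ b τ : ℝ) (hc : 0 < c) (hτ : 0 < τ) (hσ : 0 < σ) (hb : σ ≤ b) :
    ∫ r in σ..b, Real.cos (r * (c * τ)) * g
      = g * ((Real.sin (b * (c * τ)) - Real.sin (σ * (c * τ))) / (τ * c)) := by
  rw [intervalIntegral.integral_mul_const, intervalIntegral.integral_comp_mul_right _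
    (mul_pos hc hτ).ne', integral_cos, smul_eq_mul]
  field_simp

lemma inner_eq (ν : ℝ) (hν1 : ν < 1) (v u : E3) (hv : ‖v‖ ≤ ν) (hu : ‖u‖ ≤ ν)
    (σ b τ : ℝ) (hσ : 0 < σ) (hb : σ ≤ b) (hτ : 0 < τ) :
    ⟪u, ∫ k in annulus σ b, Real.cos (⟪k, u⟫ * τ - ‖k‖ * τ) • Sig v k⟫
      = ∫ ω : Metric.sphere (0 : E3) 1, Gang v u ω *
        ((Real.sin (b * ((1 - ⟪(ω : E3), u⟫) * τ)) - Real.sin (σ * ((1 - ⟪(ω : E3), u⟫) * τ))) /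
          (τ * (1 - ⟪(ω : E3), u⟫))) ∂((volume : Measure E3).toSphere) := by
  have hint := Sig_int ν hν1 v u hv σ b τ hσ
  have hms : MeasurableSet (annulus σ b) := (annulus_compact σ b).measurableSet
  rw [← integral_inner hint u, ← integral_indicator hms, polarE3 _
    ((integrable_indicator_iff hms).2 (hint.const_inner u))]
  congr 1
  funext ω
  have hω : ‖(ω : E3)‖ = 1 := by simpa using ω.2
  have hc : 0 < 1 - ⟪(ω : E3), u⟫ := by
    linarith [(abs_le.1 (inner_unit_le ν u ω hu hω)).2]
  rw [← radial _ _ _ _ _ hc hτ hσ hb, intervalIntegral.integral_of_le hb,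
    ← integral_Icc_eq_integral_Ioc]
  have hI : Set.Icc σ b = Set.Ioi 0 ∩ Set.Icc σ b := by
    rw [Set.inter_eq_self_of_subset_right]
    exact fun x hx => hσ.trans_le hx.1
  rw [hI, ← setIntegral_indicator measurableSet_Icc]
  refine setIntegral_congr_fun measurableSet_Ioi fun r hr => ?_
  have hr0 : 0 < r := hr
  have hn : ‖r • (ω : E3)‖ = r := by
    rw [norm_smul, hω, Real.norm_eq_abs, abs_of_pos hr0, mul_one]
  by_cases hm : r ∈ Set.Icc σ b
  · have hm' : r • (ω : E3) ∈ annulus σ b := by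
      simp only [annulus, Set.mem_ofPred_eq, hn]
      exact hm
    simp only [Set.indicator_of_mem hm, Set.indicator_of_mem hm', hn]
    rw [inner_smul_right, ← Sig_polar v u ω r hr0 hω, inner_smul_left]
    have : Real.cos ((starRingEnd ℝ) r * ⟪(ω : E3), u⟫ * τ - r * τ)
        = Real.cos (r * ((1 - ⟪(ω : E3), u⟫) * τ)) := by
      rw [← Real.cos_neg]
      congr 1
      simp only [conj_trivial]
      ring
    rw [this]
    ring
  · have hm' : r • (ω : E3) ∉ annulus σ b := by
      simp only [annulus, Set.mem_ofPred_eq, hn]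
      exact hm
    simp only [Set.indicator_of_notMem hm, Set.indicator_of_notMem hm', mul_zero]

lemma tau_bound (θ c g σ T : ℝ) (hθ1 : θ < 1) (hc : 0 < c) (hσ : 0 < σ) (hT : 1 ≤ T) :
    |∫ τ in (1:ℝ)..T, g * ((Real.sin (τ ^ (-θ) * (c * τ)) - Real.sin (σ * (c * τ))) / (τ * c))|
      ≤ |g| * ((4 / (1 - θ) + 4) / c) := by
  have hpos : ∀ x ∈ Set.uIcc 1 T, 0 < x := by
    intro x hx
    rw [Set.uIcc_of_le hT] at hx
    linarith [hx.1]
  have h1 := osc_bound c (1 - θ) T hc (by linarith) hT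
  have h2 := osc_bound (σ * c) 1 T (by positivity) one_pos hT
  have hii : ∀ l p : ℝ,
      IntervalIntegrable (fun τ : ℝ => Real.sin (l * τ ^ p) / τ) volume 1 T := by
    intro l p
    apply ContinuousOn.intervalIntegrable
    refine ContinuousOn.div ?_ continuousOn_id (fun x hx => (hpos x hx).ne')
    refine Real.continuous_sin.comp_continuousOn (continuousOn_const.mul ?_)
    exact continuousOn_id.rpow_const fun x hx => Or.inl (hpos x hx).ne'
  have h3 : ∫ τ in (1:ℝ)..T, g * ((Real.sin (τ ^ (-θ) * (c * τ)) - Real.sin (σ * (c * τ))) / (τ * c))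
      = (g / c) * ((∫ τ in (1:ℝ)..T, Real.sin (c * τ ^ (1 - θ)) / τ)
          - ∫ τ in (1:ℝ)..T, Real.sin (σ * c * τ ^ (1:ℝ)) / τ) := by
    rw [← intervalIntegral.integral_sub (hii _ _) (hii _ _),
      ← intervalIntegral.integral_const_mul]
    apply intervalIntegral.integral_congr
    intro x hx
    have hx0 := hpos x hx
    have e1 : x ^ (-θ) * (c * x) = c * x ^ (1 - θ) := by
      rw [sub_eq_neg_add, Real.rpow_add hx0, Real.rpow_one]
      ring
    simp only [e1, Real.rpow_one, mul_assoc]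
    field_simp
  rw [h3, abs_mul, abs_div, abs_of_pos hc, div_mul_eq_mul_div, mul_div_assoc]
  gcongr
  refine (abs_sub _ _).trans ?_
  rw [div_one] at h2
  linarith

/-- Uniform boundedness of the infrared phase in the infrared cutoff σ and in time t. -/
theorem statement8 (θ α ν : ℝ) (hθ0 : 0 < θ) (hθ1 : θ < 1) (hα : 0 < α)
    (hν0 : 0 < ν) (hν1 : ν < 1) :
    ∃ C : ℝ, ∀ σ : ℝ, 0 < σ → σ < 1 → ∀ t : ℝ, 1 ≤ t →
      ∀ v u : E3, ‖v‖ ≤ ν → ‖u‖ ≤ ν →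
      |gammaIR α θ v u σ t| ≤ C := by
  set S := (volume : Measure E3).toSphere with hS
  refine ⟨α * ((4 / (1 - ν)) * ((4 / (1 - θ) + 4) / (1 - ν)) * S.real Set.univ), ?_⟩
  intro σ hσ hσ1 t ht v u hv hu
  have hν : 0 < 1 - ν := by linarith
  have hθ : 0 < 1 - θ := by linarith
  have hωn : ∀ ω : Metric.sphere (0 : E3) 1, ‖(ω : E3)‖ = 1 := fun ω => by simpa using ω.2
  have hcν : ∀ ω : Metric.sphere (0 : E3) 1, 1 - ν ≤ 1 - ⟪(ω : E3), u⟫ := fun ω => by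
    linarith [(abs_le.1 (inner_unit_le ν u ω hu (hωn ω))).2]
  have hcν' : ∀ ω : Metric.sphere (0 : E3) 1, 1 - ν ≤ 1 - ⟪(ω : E3), v⟫ := fun ω => by
    linarith [(abs_le.1 (inner_unit_le ν v ω hv (hωn ω))).2]
  set T := min t (σ ^ (-(1/θ))) with hTdef
  have hT : 1 ≤ T := le_min ht
    (Real.one_le_rpow_of_pos_of_le_one_of_nonpos hσ hσ1.le (by simp [hθ0.le]))
  have hb : ∀ τ ∈ Set.uIcc 1 T, 0 < τ ∧ σ ≤ τ ^ (-θ) := by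
    intro τ hτ
    rw [Set.uIcc_of_le hT] at hτ
    have h0 : 0 < τ := by linarith [hτ.1]
    refine ⟨h0, ?_⟩
    have h1 : τ ≤ σ ^ (-(1/θ)) := hτ.2.trans (min_le_right _ _)
    have h2 := Real.rpow_le_rpow_of_nonpos h0 h1 (neg_nonpos.2 hθ0.le)
    rwa [← Real.rpow_mul hσ.le, show -(1/θ) * -θ = 1 by field_simp, Real.rpow_one] at h2
  unfold gammaIR
  rw [← hTdef, abs_mul, abs_neg, abs_of_pos hα]
  gcongr
  rw [intervalIntegral.integral_congr (g := fun τ => ∫ ω : Metric.sphere (0 : E3) 1, Gang v u ω *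
        ((Real.sin (τ ^ (-θ) * ((1 - ⟪(ω : E3), u⟫) * τ))
          - Real.sin (σ * ((1 - ⟪(ω : E3), u⟫) * τ))) /
          (τ * (1 - ⟪(ω : E3), u⟫))) ∂S)
    (fun τ hτ => inner_eq ν hν1 v u hv hu σ (τ ^ (-θ)) τ hσ (hb τ hτ).2 (hb τ hτ).1)]
  rw [intervalIntegral_integral_swap]
  · rw [← Real.norm_eq_abs]
    refine norm_integral_le_of_norm_le_const (.of_forall fun ω => ?_)
    have hc := hcν ω
    rw [Real.norm_eq_abs]
    refine (tau_bound θ _ _ σ T hθ1 (hν.trans_le hc) hσ hT).trans ?_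
    have hG := Gang_bound ν hν1 v u ω hv hu (hωn ω)
    have hc0 : 0 ≤ (4 / (1 - θ) + 4) / (1 - ⟪(ω : E3), u⟫) :=
      div_nonneg (by positivity) (hν.le.trans hc)
    gcongr
  · have hcv : Measurable fun ω : Metric.sphere (0 : E3) 1 => ⟪(ω : E3), v⟫ :=
      (by fun_prop : Continuous fun ω : Metric.sphere (0 : E3) 1 => ⟪(ω : E3), v⟫).measurable
    have hcu : Measurable fun ω : Metric.sphere (0 : E3) 1 => ⟪(ω : E3), u⟫ :=
      (by fun_prop : Continuous fun ω : Metric.sphere (0 : E3) 1 => ⟪(ω : E3), u⟫).measurable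
    have hcu' : Measurable fun ω : Metric.sphere (0 : E3) 1 => ⟪u, (ω : E3)⟫ :=
      (by fun_prop : Continuous fun ω : Metric.sphere (0 : E3) 1 => ⟪u, (ω : E3)⟫).measurable
    have hGm : Measurable fun ω : Metric.sphere (0 : E3) 1 => Gang v u ω := by
      unfold Gang
      fun_prop
    have hfS : IsFiniteMeasure S := by rw [hS]; infer_instance
    have hfI : IsFiniteMeasure ((volume : Measure ℝ).restrict (Set.uIoc 1 T)) :=
      ⟨by rw [Measure.restrict_apply_univ, Set.uIoc_of_le hT]; exact measure_Ioc_lt_top⟩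
    refine Integrable.of_bound (C := 4 / (1 - ν) * (2 / (1 * (1 - ν)))) ?_ ?_
    · apply Measurable.aestronglyMeasurable
      unfold Function.uncurry
      have h2 : Measurable fun p : ℝ × Metric.sphere (0 : E3) 1 => ⟪(p.2 : E3), u⟫ :=
        hcu.comp measurable_snd
      have h3 : Measurable fun p : ℝ × Metric.sphere (0 : E3) 1 => Gang v u p.2 :=
        hGm.comp measurable_snd
      fun_prop
    · have hae : ∀ᵐ p ∂((volume.restrict (Set.uIoc 1 T)).prod S), p.1 ∈ Set.uIoc 1 T :=
        Measure.quasiMeasurePreserving_fst.ae (ae_restrict_mem measurableSet_uIoc)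
      filter_upwards [hae] with p hp
      rw [Set.uIoc_of_le hT] at hp
      have h1 : 1 ≤ p.1 := hp.1.le
      have hc := hcν p.2
      have hG := Gang_bound ν hν1 v u p.2 hv hu (hωn p.2)
      simp only [Function.uncurry]
      rw [Real.norm_eq_abs, abs_mul, abs_div,
        abs_of_pos (mul_pos (by linarith : 0 < p.1) (hν.trans_le hc))]
      have hnum : |Real.sin (p.1 ^ (-θ) * ((1 - ⟪(p.2 : E3), u⟫) * p.1))
          - Real.sin (σ * ((1 - ⟪(p.2 : E3), u⟫) * p.1))| ≤ 2 := by
        refine (abs_sub _ _).trans ?_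
        linarith [Real.abs_sin_le_one (p.1 ^ (-θ) * ((1 - ⟪(p.2 : E3), u⟫) * p.1)),
          Real.abs_sin_le_one (σ * ((1 - ⟪(p.2 : E3), u⟫) * p.1))]
      have hden : 1 * (1 - ν) ≤ p.1 * (1 - ⟪(p.2 : E3), u⟫) :=
        mul_le_mul h1 hc hν.le (by linarith)
      have hden0 : 0 < 1 * (1 - ν) := by linarith
      exact mul_le_mul hG (div_le_div₀ zero_le_two hnum hden0 hden)
        (div_nonneg (abs_nonneg _) (hden0.le.trans hden)) (by positivity)
end
end

section
/- Let θ ∈ (0,1), α > 0 and 0 < ν < 1, and fix vectors v, u ∈ ℝ³ with |v| ≤ ν and |u| ≤ ν. Then the limit lim_{σ → 0⁺} γ_σ(v, u, σ^{−1/θ}) exists in ℝ; that is, the infrared phase converges as the infrared cutoff is removed. -/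
open MeasureTheory
open scoped RealInnerProductSpace

noncomputable section

open Filter Topology Set

/-- sine integral -/
def Si (x : ℝ) : ℝ := ∫ s in (0:ℝ)..x, Real.sinc s

lemma Si_hasDerivAt (x : ℝ) : HasDerivAt Si (Real.sinc x) x :=
  Real.continuous_sinc.integral_hasStrictDerivAt 0 x |>.hasDerivAt

lemma Si_continuous : Continuous Si :=
  continuous_iff_continuousAt.2 fun x => (Si_hasDerivAt x).continuousAt

lemma Si_zero : Si 0 = 0 := by simp [Si]

lemma Si_lim : ∃ L : ℝ, Tendsto Si atTop (𝓝 L) := by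
  have h1 : ∀ x ∈ Ioi (1:ℝ), HasDerivAt (fun x => Si x + Real.cos x / x)
      (-Real.cos x / x ^ 2) x := by
    intro x hx
    have hx0 : x ≠ 0 := by have : (1:ℝ) < x := hx; positivity
    have := (Si_hasDerivAt x).add ((Real.hasDerivAt_cos x).div (hasDerivAt_id x) hx0)
    have e : Real.sinc x + (-Real.sin x * id x - Real.cos x * 1) / id x ^ 2
        = -Real.cos x / x ^ 2 := by
      rw [Real.sinc_of_ne_zero hx0]
      simp only [id]
      field_simp
      ring
    rw [e] at this
    exact this
  have h2 : IntegrableOn (fun x : ℝ => -Real.cos x / x ^ 2) (Ioi 1) := by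
    have h := integrableOn_Ioi_rpow_of_lt (a := -2) (c := 1) (by norm_num) one_pos
    refine Integrable.mono' h ?_ ?_
    · exact Measurable.aestronglyMeasurable (by fun_prop)
    · filter_upwards [ae_restrict_mem measurableSet_Ioi] with x hx
      have hx0 : (0:ℝ) < x := lt_trans one_pos hx
      rw [Real.rpow_neg hx0.le, norm_div, norm_neg, Real.norm_eq_abs, div_eq_mul_inv]
      have : ‖x^2‖ = x ^ (2:ℝ) := by
        rw [Real.norm_of_nonneg (by positivity)]; norm_cast
      rw [this]
      have := Real.abs_cos_le_one x
      have h3 : 0 ≤ (x ^ (2:ℝ))⁻¹ := by positivity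
      nlinarith
  have h3 := tendsto_limUnder_of_hasDerivAt_of_integrableOn_Ioi h1 h2
  have h4 : Tendsto (fun x : ℝ => Real.cos x / x) atTop (𝓝 0) := by
    have := (tendsto_inv_atTop_zero (𝕜 := ℝ))
    refine squeeze_zero_norm' ?_ this
    filter_upwards [eventually_gt_atTop 0] with x hx
    rw [norm_div, Real.norm_eq_abs, Real.norm_of_nonneg hx.le, div_eq_mul_inv]
    have := Real.abs_cos_le_one x
    have h3 : 0 ≤ x⁻¹ := by positivity
    nlinarith
  exact ⟨_, by simpa using h3.sub h4⟩

lemma Si_bdd : ∃ C : ℝ, ∀ x, 0 ≤ x → |Si x| ≤ C := by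
  obtain ⟨L, hL⟩ := Si_lim
  have h1 : ∀ᶠ x in atTop, |Si x| < |L| + 1 :=
    hL.abs.eventually (gt_mem_nhds (by linarith))
  obtain ⟨N, hN⟩ := eventually_atTop.1 h1
  obtain ⟨C, hC⟩ := (isCompact_Icc (a := (0:ℝ)) (b := N)).exists_bound_of_continuousOn
    Si_continuous.continuousOn
  refine ⟨max C (|L| + 1), fun x hx => ?_⟩
  rcases le_total x N with h | h
  · exact le_trans (hC x ⟨hx, h⟩) (le_max_left _ _)
  · exact le_trans (hN x h).le (le_max_right _ _)

/-- polar coordinates -/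
lemma polar (f : E3 → ℝ) (hf : Integrable f) :
    ∫ k, f k = ∫ w : Metric.sphere (0:E3) 1, (∫ r in Ioi (0:ℝ), r ^ 2 * f (r • (w : E3)))
      ∂(volume : Measure E3).toSphere := by
  have hd : Module.finrank ℝ E3 = 3 := by simp
  have hmp := (volume : Measure E3).measurePreserving_homeomorphUnitSphereProd
  rw [hd] at hmp
  have hsymm : ∀ x : ({0}ᶜ : Set E3),
      ((homeomorphUnitSphereProd E3 x).2 : ℝ) • ((homeomorphUnitSphereProd E3 x).1 : E3) = x := by
    intro x
    have := congrArg Subtype.val ((homeomorphUnitSphereProd E3).symm_apply_apply x)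
    rwa [homeomorphUnitSphereProd_symm_apply_coe] at this
  set g : Metric.sphere (0:E3) 1 × Ioi (0:ℝ) → ℝ := fun p => f ((p.2 : ℝ) • (p.1 : E3)) with hg
  have hcomp : (g ∘ homeomorphUnitSphereProd E3) = fun x : ({0}ᶜ : Set E3) => f x := by
    funext x; simp only [hg, Function.comp, hsymm]
  have hint : Integrable g ((volume : Measure E3).toSphere.prod (.volumeIoiPow 2)) := by
    rw [← hmp.integrable_comp_emb (Homeomorph.measurableEmbedding _), hcomp]
    have : IntegrableOn f ({0}ᶜ : Set E3) := hf.integrableOn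
    rwa [integrableOn_iff_comap_subtypeVal (measurableSet_singleton _).compl] at this
  calc
    ∫ k, f k = ∫ x : ({(0)}ᶜ : Set E3), f x.1 ∂((volume : Measure E3).comap (↑)) := by
      rw [integral_subtype_comap (measurableSet_singleton _).compl fun x ↦ f x,
        restrict_compl_singleton]
    _ = ∫ x, g x ∂(volume : Measure E3).toSphere.prod (.volumeIoiPow 2) := by
      rw [← hmp.integral_comp (Homeomorph.measurableEmbedding _) g]
      exact congrArg (fun h => ∫ x, h x ∂_) hcomp.symm
    _ = ∫ w, ∫ r, g (w, r) ∂(.volumeIoiPow 2) ∂(volume : Measure E3).toSphere :=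
      integral_prod _ hint
    _ = _ := by
      congr 1; funext w
      simp only [Measure.volumeIoiPow, ENNReal.ofReal, hg]
      rw [integral_withDensity_eq_integral_smul,
        integral_subtype_comap measurableSet_Ioi
          fun a ↦ Real.toNNReal (a ^ 2) • f (a • (w : E3)),
        setIntegral_congr_fun measurableSet_Ioi fun x hx ↦ ?_]
      · simp only [NNReal.smul_def, Real.coe_toNNReal _ (pow_nonneg (le_of_lt hx) _), smul_eq_mul]
      · exact (measurable_subtype_coe.pow_const _).real_toNNReal

lemma den_pos {ν : ℝ} {v k : E3} (hv : ‖v‖ ≤ ν) : 1 - ν ≤ 1 - ⟪k, v⟫ / ‖k‖ := by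
  have h1 : ⟪k, v⟫ ≤ ‖k‖ * ‖v‖ := real_inner_le_norm k v
  have : ⟪k, v⟫ / ‖k‖ ≤ ν := by
    rcases eq_or_ne k 0 with rfl | hk
    · simpa using (norm_nonneg v).trans hv
    · rw [div_le_iff₀ (norm_pos_iff.2 hk)]
      nlinarith [norm_nonneg k]
  linarith

lemma Sig_bound {ν : ℝ} (hν1 : ν < 1) {v k : E3} (hv : ‖v‖ ≤ ν) :
    ‖Sig v k‖ ≤ 4 / (1 - ν) / ‖k‖ ^ 2 := by
  rcases eq_or_ne k 0 with rfl | hk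
  · simp [Sig]
  have hk0 : 0 < ‖k‖ := norm_pos_iff.2 hk
  have hd := den_pos (k := k) hv
  have hd0 : 0 < 1 - ν := by linarith
  have h1 : ‖v - (⟪k, v⟫ / ‖k‖ ^ 2) • k‖ ≤ 2 := by
    have h2 : ‖(⟪k, v⟫ / ‖k‖ ^ 2) • k‖ ≤ ‖v‖ := by
      rw [norm_smul, norm_div, norm_pow, norm_norm, div_mul_eq_mul_div,
        div_le_iff₀ (by positivity)]
      have := abs_real_inner_le_norm k v
      rw [Real.norm_eq_abs]
      nlinarith
    have := norm_sub_le v ((⟪k, v⟫ / ‖k‖ ^ 2) • k)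
    linarith
  rw [Sig, norm_smul, Real.norm_of_nonneg (by
    have : 0 ≤ 1 - ⟪k, v⟫ / ‖k‖ := by linarith
    positivity)]
  calc 2 / (‖k‖ ^ 2 * (1 - ⟪k, v⟫ / ‖k‖)) * ‖v - (⟪k, v⟫ / ‖k‖ ^ 2) • k‖
      ≤ 2 / (‖k‖ ^ 2 * (1 - ν)) * 2 := by gcongr
    _ = _ := by field_simp; norm_num

lemma Sig_smul (v w : E3) (hw : ‖w‖ = 1) {r : ℝ} (hr : 0 < r) :
    r ^ 2 • Sig v (r • w) = Sig v w := by
  simp only [Sig, norm_smul, hw, real_inner_smul_left, Real.norm_of_nonneg hr.le, smul_smul]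
  have e1 : r * ⟪w, v⟫ / (r * 1) ^ 2 * r = ⟪w, v⟫ / 1 ^ 2 := by field_simp
  have e2 : r * ⟪w, v⟫ / (r * 1) = ⟪w, v⟫ / 1 := by field_simp
  rw [e1, e2]
  congr 1
  rw [show (r * 1) ^ 2 = r ^ 2 by ring, one_pow, one_mul, ← mul_div_assoc,
    mul_div_mul_left _ _ (by positivity)]

lemma Sig_measurable (v : E3) : Measurable (Sig v) := by
  unfold Sig
  fun_prop

lemma annulus_meas (a b : ℝ) : MeasurableSet (annulus a b) :=
  (measurableSet_le measurable_const measurable_norm).inter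
    (measurableSet_le measurable_norm measurable_const)

lemma inner_int {ν : ℝ} (hν1 : ν < 1) {v u : E3} (hv : ‖v‖ ≤ ν) (hu : ‖u‖ ≤ ν)
    {σ b τ : ℝ} (hσ : 0 < σ) (hb : σ ≤ b) (hτ : 0 < τ) :
    ⟪u, ∫ k in annulus σ b, Real.cos (⟪k, u⟫ * τ - ‖k‖ * τ) • Sig v k⟫ =
    ∫ w : Metric.sphere (0:E3) 1, ⟪u, Sig v w⟫ *
      ((Real.sin (b * τ * (1 - ⟪(w:E3), u⟫)) - Real.sin (σ * τ * (1 - ⟪(w:E3), u⟫)))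
        / (τ * (1 - ⟪(w:E3), u⟫))) ∂(volume : Measure E3).toSphere := by
  have hd0 : 0 < 1 - ν := by linarith
  have hint : IntegrableOn (fun k => Real.cos (⟪k, u⟫ * τ - ‖k‖ * τ) • Sig v k)
      (annulus σ b) := by
    refine Measure.integrableOn_of_bounded (M := 4 / (1 - ν) / σ ^ 2) ?_ ?_ ?_
    · refine ne_top_of_le_ne_top (measure_closedBall_lt_top (x := (0:E3)) (r := b)).ne
        (measure_mono fun k hk => ?_)
      simpa using hk.2
    · have := Sig_measurable v
      exact Measurable.aestronglyMeasurable (by fun_prop)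
    · filter_upwards [ae_restrict_mem (annulus_meas σ b)] with k hk
      rw [norm_smul]
      have h1 : ‖Real.cos (⟪k, u⟫ * τ - ‖k‖ * τ)‖ ≤ 1 := Real.abs_cos_le_one _
      have h2 := Sig_bound (k := k) hν1 hv
      have h3 : 4 / (1 - ν) / ‖k‖ ^ 2 ≤ 4 / (1 - ν) / σ ^ 2 := by
        have := hk.1
        gcongr
      calc _ ≤ 1 * ‖Sig v k‖ := by gcongr
        _ ≤ _ := by linarith
  rw [← integral_inner hint, ← integral_indicator (annulus_meas σ b), polar _
    ((integrable_indicator_iff (annulus_meas σ b)).2 (hint.const_inner u))]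
  congr 1
  funext w
  have hw : ‖(w:E3)‖ = 1 := by simp
  have hc : 0 < 1 - ⟪(w:E3), u⟫ := by
    have := den_pos (k := (w:E3)) hu
    rw [hw, div_one] at this
    linarith
  set c := 1 - ⟪(w:E3), u⟫ with hcdef
  have e1 : ∫ r in Ioi (0:ℝ), r ^ 2 * (annulus σ b).indicator
      (fun k => ⟪u, Real.cos (⟪k, u⟫ * τ - ‖k‖ * τ) • Sig v k⟫) (r • (w:E3)) =
      ∫ r in Ioi (0:ℝ), (Icc σ b).indicator
        (fun r => ⟪u, Sig v w⟫ * Real.cos (τ * c * r)) r := by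
    refine setIntegral_congr_fun measurableSet_Ioi fun r hr => ?_
    have hr0 : (0:ℝ) < r := hr
    have hn : ‖r • (w:E3)‖ = r := by rw [norm_smul, hw, Real.norm_of_nonneg hr0.le, mul_one]
    have hmem : r • (w:E3) ∈ annulus σ b ↔ r ∈ Icc σ b := by
      simp only [annulus, mem_ofPred_eq, hn, mem_Icc]
    by_cases h : r ∈ Icc σ b
    · simp only [indicator_of_mem h, indicator_of_mem (hmem.2 h)]
      rw [← Sig_smul v w hw hr0, hn]
      simp only [real_inner_smul_left, real_inner_smul_right]
      have : r * ⟪(w:E3), u⟫ * τ - r * τ = -(τ * c * r) := by rw [hcdef]; ring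
      rw [this, Real.cos_neg]
      ring
    · simp only [indicator_of_notMem h, indicator_of_notMem (fun h' => h (hmem.1 h')), mul_zero]
  rw [e1, setIntegral_indicator measurableSet_Icc]
  have e2 : Ioi (0:ℝ) ∩ Icc σ b = Icc σ b :=
    inter_eq_right.2 fun x hx => lt_of_lt_of_le hσ hx.1
  rw [e2, integral_const_mul, integral_Icc_eq_integral_Ioc,
    ← intervalIntegral.integral_of_le hb]
  congr 1
  rw [intervalIntegral.integral_comp_mul_left (fun x => Real.cos x) (by positivity), integral_cos,
    smul_eq_mul, inv_mul_eq_div]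
  congr 3 <;> ring_nf

lemma time_int {θ σ c T : ℝ} (hθ1 : θ < 1) (hσ : 0 < σ) (hc : 0 < c) (hT : 1 ≤ T) :
    ∫ τ in (1:ℝ)..T, (Real.sin (τ ^ (-θ) * τ * c) - Real.sin (σ * τ * c)) / (τ * c) =
      ((Si (c * T ^ (1 - θ)) - Si c) / (1 - θ) - (Si (c * (σ * T)) - Si (c * σ))) / c := by
  have hpos : ∀ τ ∈ uIcc 1 T, (0:ℝ) < τ := by
    intro τ hτ
    rw [uIcc_of_le hT] at hτ
    linarith [hτ.1]
  have hθ : 1 - θ ≠ 0 := by linarith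
  have hderiv : ∀ τ ∈ uIcc 1 T, HasDerivAt
      (fun τ : ℝ => (Si (c * τ ^ (1 - θ)) / (1 - θ) - Si (c * (σ * τ))) / c)
      ((Real.sin (τ ^ (-θ) * τ * c) - Real.sin (σ * τ * c)) / (τ * c)) τ := by
    intro τ hτ
    have h0 := hpos τ hτ
    have hp : 0 < τ ^ (-θ) := Real.rpow_pos_of_pos h0 _
    have e0 : τ ^ (1 - θ) = τ ^ (-θ) * τ := by
      rw [show 1 - θ = -θ + 1 by ring, Real.rpow_add h0, Real.rpow_one]
    have d1 : HasDerivAt (fun τ : ℝ => c * τ ^ (1 - θ)) (c * ((1 - θ) * τ ^ (1 - θ - 1))) τ :=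
      (Real.hasDerivAt_rpow_const (Or.inl h0.ne')).const_mul c
    have d2 : HasDerivAt (fun τ : ℝ => c * (σ * τ)) (c * σ) τ := by
      simpa [mul_assoc] using (hasDerivAt_id τ).const_mul (c * σ)
    have d3 := (((Si_hasDerivAt _).comp τ d1).div_const (1 - θ)).sub
      ((Si_hasDerivAt _).comp τ d2) |>.div_const c
    have e : (Real.sinc (c * τ ^ (1 - θ)) * (c * ((1 - θ) * τ ^ (1 - θ - 1))) / (1 - θ) -
        Real.sinc (c * (σ * τ)) * (c * σ)) / c =
        (Real.sin (τ ^ (-θ) * τ * c) - Real.sin (σ * τ * c)) / (τ * c) := by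
      rw [show 1 - θ - 1 = -θ by ring, e0, Real.sinc_of_ne_zero (by positivity),
        Real.sinc_of_ne_zero (by positivity), mul_comm c (τ ^ (-θ) * τ), mul_comm c (σ * τ)]
      field_simp
    rw [e] at d3
    exact d3
  rw [intervalIntegral.integral_eq_sub_of_hasDerivAt hderiv]
  · simp only [Real.one_rpow, mul_one]
    ring
  · refine ContinuousOn.intervalIntegrable fun τ hτ => ?_
    have h0 := hpos τ hτ
    have : ContinuousAt (fun τ : ℝ => τ ^ (-θ)) τ := Real.continuousAt_rpow_const _ _ (Or.inl h0.ne')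
    refine ContinuousAt.continuousWithinAt ?_
    refine ContinuousAt.div ?_ (by fun_prop) (by positivity)
    fun_prop

lemma gamma_formula {θ α ν : ℝ} (hθ0 : 0 < θ) (hθ1 : θ < 1)
    (hν1 : ν < 1) {v u : E3} (hv : ‖v‖ ≤ ν) (hu : ‖u‖ ≤ ν) {σ : ℝ} (hσ : 0 < σ) (hσ1 : σ < 1) :
    gammaIR α θ v u σ (σ ^ (-(1/θ))) =
    -α * ∫ w : Metric.sphere (0:E3) 1, ⟪u, Sig v w⟫ *
      (((Si ((1 - ⟪(w:E3), u⟫) * (σ * σ ^ (-(1/θ)))) - Si (1 - ⟪(w:E3), u⟫)) / (1 - θ) -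
        (Si ((1 - ⟪(w:E3), u⟫) * (σ * σ ^ (-(1/θ)))) - Si ((1 - ⟪(w:E3), u⟫) * σ)))
        / (1 - ⟪(w:E3), u⟫)) ∂(volume : Measure E3).toSphere := by
  have hd0 : 0 < 1 - ν := by linarith
  rw [gammaIR, min_self]
  congr 1
  set T := σ ^ (-(1/θ)) with hTdef
  have hT : 1 ≤ T := Real.one_le_rpow_of_pos_of_le_one_of_nonpos hσ hσ1.le
    (by have : 0 < 1 / θ := by positivity
        linarith)
  have hT0 : 0 < T := by linarith
  have hTθ : T ^ (-θ) = σ := by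
    rw [hTdef, ← Real.rpow_mul hσ.le]
    rw [show -(1/θ) * -θ = 1 by field_simp, Real.rpow_one]
  have hX : T ^ (1 - θ) = σ * T := by
    rw [show 1 - θ = -θ + 1 by ring, Real.rpow_add hT0, Real.rpow_one, hTθ]
  have hc : ∀ w : Metric.sphere (0:E3) 1, 1 - ν ≤ 1 - ⟪(w:E3), u⟫ := by
    intro w
    have hw : ‖(w:E3)‖ = 1 := by simp
    have := den_pos (k := (w:E3)) hu
    rwa [hw, div_one] at this
  have step1 : ∀ τ ∈ uIcc 1 T, ⟪u, ∫ k in annulus σ (τ ^ (-θ)),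
        Real.cos (⟪k, u⟫ * τ - ‖k‖ * τ) • Sig v k⟫ =
      ∫ w : Metric.sphere (0:E3) 1, ⟪u, Sig v w⟫ *
      ((Real.sin (τ ^ (-θ) * τ * (1 - ⟪(w:E3), u⟫)) - Real.sin (σ * τ * (1 - ⟪(w:E3), u⟫)))
        / (τ * (1 - ⟪(w:E3), u⟫))) ∂(volume : Measure E3).toSphere := by
    intro τ hτ
    rw [uIcc_of_le hT] at hτ
    have hτ0 : 0 < τ := by linarith [hτ.1]
    refine inner_int hν1 hv hu hσ ?_ hτ0
    rw [← hTθ]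
    exact Real.rpow_le_rpow_of_nonpos hτ0 hτ.2 (by linarith)
  rw [intervalIntegral.integral_congr step1, intervalIntegral_integral_swap]
  · congr 1
    funext w
    rw [intervalIntegral.integral_const_mul, time_int hθ1 hσ (lt_of_lt_of_le hd0 (hc w)) hT, hX]
  · haveI : IsFiniteMeasure ((volume : Measure ℝ).restrict (uIoc 1 T)) :=
      ⟨by rw [Measure.restrict_apply_univ, uIoc_of_le hT]; exact measure_Ioc_lt_top⟩
    refine Integrable.of_bound (C := 4 / (1 - ν) * (2 / (1 - ν))) ?_ ?_
    · have := Sig_measurable v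
      refine Measurable.aestronglyMeasurable ?_
      unfold Function.uncurry
      fun_prop
    · have hae : ∀ᵐ p ∂((volume.restrict (uIoc 1 T)).prod (volume : Measure E3).toSphere),
          p.1 ∈ uIoc 1 T :=
        Measure.quasiMeasurePreserving_fst.ae (ae_restrict_mem measurableSet_uIoc)
      filter_upwards [hae] with p hp
      obtain ⟨τ, w⟩ := p
      rw [uIoc_of_le hT] at hp
      have hτ : 1 < τ := hp.1
      have hw : ‖(w:E3)‖ = 1 := by simp
      have hcw := hc w
      have h1 : ‖⟪u, Sig v w⟫‖ ≤ 4 / (1 - ν) := by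
        have h2 := norm_inner_le_norm (𝕜 := ℝ) u (Sig v w)
        have h3 := Sig_bound (k := (w:E3)) hν1 hv
        rw [hw] at h3
        have h4 : ‖u‖ * ‖Sig v w‖ ≤ 1 * ‖Sig v w‖ := by gcongr; linarith
        norm_num at h3 ⊢
        norm_num at h2
        linarith
      simp only [Function.uncurry]
      rw [norm_mul]
      refine mul_le_mul h1 ?_ (norm_nonneg _) (by positivity)
      rw [norm_div]
      refine div_le_div₀ (by norm_num) ?_ hd0 ?_
      · refine (norm_sub_le _ _).trans ?_
        have a1 := Real.abs_sin_le_one (τ ^ (-θ) * τ * (1 - ⟪(w:E3), u⟫))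
        have a2 := Real.abs_sin_le_one (σ * τ * (1 - ⟪(w:E3), u⟫))
        simp only [Real.norm_eq_abs]
        linarith
      · refine le_trans ?_ (le_abs_self _)
        nlinarith

/-- Convergence of the infrared phase as the infrared cutoff is removed along the
coupling `t = σ^{-1/θ}`. -/
theorem statement9 (θ α ν : ℝ) (hθ0 : 0 < θ) (hθ1 : θ < 1) (hα : 0 < α)
    (hν0 : 0 < ν) (hν1 : ν < 1) (v u : E3) (hv : ‖v‖ ≤ ν) (hu : ‖u‖ ≤ ν) :
    ∃ L : ℝ, Filter.Tendsto (fun σ : ℝ => gammaIR α θ v u σ (σ ^ (-(1/θ))))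
      (nhdsWithin 0 (Set.Ioi 0)) (nhds L) := by
  obtain ⟨S, hS⟩ := Si_lim
  obtain ⟨C, hC⟩ := Si_bdd
  have hd0 : 0 < 1 - ν := by linarith
  have hθ' : 0 < 1 - θ := by linarith
  have hC0 : 0 ≤ C := (abs_nonneg _).trans (hC 0 le_rfl)
  have hc : ∀ w : Metric.sphere (0:E3) 1, 1 - ν ≤ 1 - ⟪(w:E3), u⟫ := by
    intro w
    have hw : ‖(w:E3)‖ = 1 := by simp
    have := den_pos (k := (w:E3)) hu
    rwa [hw, div_one] at this
  have hX : Tendsto (fun σ : ℝ => σ * σ ^ (-(1/θ))) (𝓝[>] 0) atTop := by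
    have h1 : 1 - 1/θ < 0 := by
      have : 1 < 1 / θ := by rw [lt_div_iff₀ hθ0]; linarith
      linarith
    refine (tendsto_rpow_neg_nhdsGT_zero h1).congr' ?_
    filter_upwards [self_mem_nhdsWithin] with σ hσ
    have hσ0 : (0:ℝ) < σ := hσ
    rw [show 1 - 1/θ = 1 + -(1/θ) by ring, Real.rpow_add hσ0, Real.rpow_one]
  refine ⟨-α * ∫ w : Metric.sphere (0:E3) 1, ⟪u, Sig v w⟫ *
      (((S - Si (1 - ⟪(w:E3), u⟫)) / (1 - θ) - (S - Si ((1 - ⟪(w:E3), u⟫) * 0)))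
        / (1 - ⟪(w:E3), u⟫)) ∂(volume : Measure E3).toSphere, ?_⟩
  have hev : ∀ᶠ σ : ℝ in 𝓝[>] 0, 0 < σ ∧ σ < 1 := Ioo_mem_nhdsGT one_pos
  refine Tendsto.congr' (f₁ := fun σ => -α * ∫ w : Metric.sphere (0:E3) 1, ⟪u, Sig v w⟫ *
      (((Si ((1 - ⟪(w:E3), u⟫) * (σ * σ ^ (-(1/θ)))) - Si (1 - ⟪(w:E3), u⟫)) / (1 - θ) -
        (Si ((1 - ⟪(w:E3), u⟫) * (σ * σ ^ (-(1/θ)))) - Si ((1 - ⟪(w:E3), u⟫) * σ)))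
        / (1 - ⟪(w:E3), u⟫)) ∂(volume : Measure E3).toSphere) ?_ ?_
  · filter_upwards [hev] with σ hσ
    exact (gamma_formula hθ0 hθ1 hν1 hv hu hσ.1 hσ.2).symm
  refine Tendsto.const_mul _ ?_
  refine tendsto_integral_filter_of_dominated_convergence
    (fun _ => 4 / (1 - ν) * (((C + C) / (1 - θ) + (C + C)) / (1 - ν))) ?_ ?_ ?_ ?_
  · refine Eventually.of_forall fun σ => Measurable.aestronglyMeasurable ?_
    have := Sig_measurable v
    have h2 := Si_continuous.measurable
    fun_prop
  · filter_upwards [hev] with σ hσ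
    refine Eventually.of_forall fun w => ?_
    have hw : ‖(w:E3)‖ = 1 := by simp
    have hcw := hc w
    have h1 : ‖⟪u, Sig v w⟫‖ ≤ 4 / (1 - ν) := by
      have h2 := norm_inner_le_norm (𝕜 := ℝ) u (Sig v w)
      have h3 := Sig_bound (k := (w:E3)) hν1 hv
      rw [hw] at h3
      have h4 : ‖u‖ * ‖Sig v w‖ ≤ 1 * ‖Sig v w‖ := by gcongr; linarith
      norm_num at h3 ⊢
      norm_num at h2
      linarith
    set c := 1 - ⟪(w:E3), u⟫ with hcdef
    have hc0 : 0 < c := by linarith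
    have hs0 := hσ.1
    rw [norm_mul]
    refine mul_le_mul h1 ?_ (norm_nonneg _) (by positivity)
    rw [norm_div]
    refine div_le_div₀ (by positivity) ?_ hd0 (hcw.trans (le_abs_self _))
    refine (norm_sub_le _ _).trans ?_
    rw [norm_div, Real.norm_of_nonneg hθ'.le]
    have b1 := hC (c * (σ * σ ^ (-(1/θ)))) (by positivity)
    have b2 := hC c hc0.le
    have b3 := hC (c * σ) (by positivity)
    have c1 : ‖Si (c * (σ * σ ^ (-(1/θ)))) - Si c‖ ≤ C + C :=
      (norm_sub_le _ _).trans (add_le_add b1 b2)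
    have c2 : ‖Si (c * (σ * σ ^ (-(1/θ)))) - Si (c * σ)‖ ≤ C + C :=
      (norm_sub_le _ _).trans (add_le_add b1 b3)
    gcongr
  · exact integrable_const _
  · refine Eventually.of_forall fun w => ?_
    have hc0 : 0 < 1 - ⟪(w:E3), u⟫ := lt_of_lt_of_le hd0 (hc w)
    have t1 : Tendsto (fun σ : ℝ => Si ((1 - ⟪(w:E3), u⟫) * (σ * σ ^ (-(1/θ))))) (𝓝[>] 0) (𝓝 S) :=
      hS.comp (hX.const_mul_atTop hc0)
    have t2 : Tendsto (fun σ : ℝ => Si ((1 - ⟪(w:E3), u⟫) * σ)) (𝓝[>] 0)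
        (𝓝 (Si ((1 - ⟪(w:E3), u⟫) * 0))) := by
      have : Continuous (fun σ : ℝ => Si ((1 - ⟪(w:E3), u⟫) * σ)) := by
        have := Si_continuous
        fun_prop
      exact (this.tendsto 0).mono_left nhdsWithin_le_nhds
    exact ((((t1.sub_const _).div_const _).sub (t1.sub t2)).div_const _).const_mul _
end
end
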